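/- arXiv:1009.4549 — 4 statements merged into one kernel-verified Lean document; each statement's English description precedes it below -/
import Mathlib

section
/- For all real parameters μ, ν, every smooth function u : (0,∞) → ℂ and every x > 0, one has D_{ν,μ}u(x) = D_{μ,ν}u(x) + (μ−ν)(μ+ν+2)·u(x). -/
noncomputable section

open Set

/-- The Euler operator `θ = x·d/dx` acting on complex-valued functions on `ℝ`. -/
def eulerOp (u : ℝ → ℂ) : ℝ → ℂ := fun x => (x : ℂ) * deriv u x

/-- The operator `(θ + a)(θ + b) − x²` applied to `v`. -/
def quadOp (a b : ℝ) (v : ℝ → ℂ) : ℝ → ℂ := fun x =>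
  eulerOp (fun y => eulerOp v y + (b : ℂ) * v y) x
    + (a : ℂ) * (eulerOp v x + (b : ℂ) * v x) - (x : ℂ) ^ 2 * v x

/-- The fourth-order operator `D_{μ,ν} = x⁻²((θ+μ+ν)(θ+μ) − x²)(θ(θ+ν) − x²)`. -/
def Dop (μ ν : ℝ) (u : ℝ → ℂ) : ℝ → ℂ := fun x =>
  quadOp (μ + ν) μ (quadOp 0 ν u) x / (x : ℂ) ^ 2

/-- `quadOp` expanded in terms of the first two derivatives. -/
theorem quadOp_eq_of_hasDerivAt {v v₁ v₂ : ℝ → ℂ} (a b : ℝ)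
    (h₁ : ∀ y : ℝ, 0 < y → HasDerivAt v (v₁ y) y)
    (h₂ : ∀ y : ℝ, 0 < y → HasDerivAt v₁ (v₂ y) y) {x : ℝ} (hx : 0 < x) :
    quadOp a b v x = (x : ℂ) ^ 2 * v₂ x + (1 + a + b) * x * v₁ x
      + (a * b - (x : ℂ) ^ 2) * v x := by
  have hid : HasDerivAt (fun y : ℝ => (y : ℂ)) 1 x := (hasDerivAt_id x).ofReal_comp
  have heq : (fun y => eulerOp v y + (b : ℂ) * v y)
      =ᶠ[nhds x] fun y => (y : ℂ) * v₁ y + (b : ℂ) * v y := by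
    filter_upwards [Ioi_mem_nhds hx] with y hy
    simp only [eulerOp, (h₁ y hy).deriv]
  have hd := ((hid.mul (h₂ x hx)).add ((h₁ x hx).const_mul (b : ℂ))).congr_of_eventuallyEq heq
  simp only [quadOp]
  rw [eulerOp, hd.deriv, eulerOp, (h₁ x hx).deriv]
  ring

/-- A smooth function on `(0,∞)` has a smooth derivative there. -/
theorem exists_hasDerivAt_of_contDiffOn_Ioi {u : ℝ → ℂ}
    (hu : ContDiffOn ℝ (⊤ : ℕ∞) u (Ioi (0 : ℝ))) :
    ∃ u' : ℝ → ℂ, ContDiffOn ℝ (⊤ : ℕ∞) u' (Ioi (0 : ℝ)) ∧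
      ∀ y : ℝ, 0 < y → HasDerivAt u (u' y) y :=
  ⟨deriv u, hu.deriv_of_isOpen isOpen_Ioi (by simp), fun _ hy =>
    ((hu.differentiableOn (by simp)).differentiableAt (Ioi_mem_nhds hy)).hasDerivAt⟩

/-- `D_{μ,ν}` expanded in terms of the first four derivatives. -/
theorem Dop_eq_of_hasDerivAt {u u₁ u₂ u₃ u₄ : ℝ → ℂ} (μ ν : ℝ)
    (h₁ : ∀ y : ℝ, 0 < y → HasDerivAt u (u₁ y) y)
    (h₂ : ∀ y : ℝ, 0 < y → HasDerivAt u₁ (u₂ y) y)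
    (h₃ : ∀ y : ℝ, 0 < y → HasDerivAt u₂ (u₃ y) y)
    (h₄ : ∀ y : ℝ, 0 < y → HasDerivAt u₃ (u₄ y) y) {x : ℝ} (hx : 0 < x) :
    Dop μ ν u x =
      ((x : ℂ) ^ 2 * ((x : ℂ) ^ 2 * u₄ x + (5 + ν) * x * u₃ x
          + (4 + 2 * ν - (x : ℂ) ^ 2) * u₂ x - 4 * x * u₁ x - 2 * u x)
        + (1 + 2 * μ + ν) * x * ((x : ℂ) ^ 2 * u₃ x + (3 + ν) * x * u₂ x
          + (1 + ν - (x : ℂ) ^ 2) * u₁ x - 2 * x * u x)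
        + ((μ + ν) * μ - (x : ℂ) ^ 2) * ((x : ℂ) ^ 2 * u₂ x + (1 + ν) * x * u₁ x
          - (x : ℂ) ^ 2 * u x)) / (x : ℂ) ^ 2 := by
  have hid (y : ℝ) : HasDerivAt (fun y : ℝ => (y : ℂ)) 1 y := (hasDerivAt_id y).ofReal_comp
  have hw {y : ℝ} (hy : 0 < y) := quadOp_eq_of_hasDerivAt 0 ν h₁ h₂ hy
  have hw₁ (y : ℝ) (hy : 0 < y) : HasDerivAt (quadOp 0 ν u)
      ((y : ℂ) ^ 2 * u₃ y + (3 + ν) * y * u₂ y + (1 + ν - (y : ℂ) ^ 2) * u₁ y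
        - 2 * y * u y) y := by
    have hd := ((((hid y).pow 2).mul (h₃ y hy)).add
      (((hid y).const_mul (1 + ν : ℂ)).mul (h₂ y hy))).sub (((hid y).pow 2).mul (h₁ y hy))
    refine (hd.congr_of_eventuallyEq ?_).congr_deriv ?_
    · filter_upwards [Ioi_mem_nhds hy] with z hz
      simp [hw hz]
      ring
    · simp
      ring
  have hw₂ (y : ℝ) (hy : 0 < y) : HasDerivAt (fun y : ℝ =>
      (y : ℂ) ^ 2 * u₃ y + (3 + ν) * y * u₂ y + (1 + ν - (y : ℂ) ^ 2) * u₁ y - 2 * y * u y)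
      ((y : ℂ) ^ 2 * u₄ y + (5 + ν) * y * u₃ y + (4 + 2 * ν - (y : ℂ) ^ 2) * u₂ y
        - 4 * y * u₁ y - 2 * u y) y := by
    have hd := (((((hid y).pow 2).mul (h₄ y hy)).add
      (((hid y).const_mul (3 + ν : ℂ)).mul (h₃ y hy))).add
      ((((hid y).pow 2).const_sub (1 + ν : ℂ)).mul (h₂ y hy))).sub
      (((hid y).const_mul (2 : ℂ)).mul (h₁ y hy))
    refine hd.congr_deriv ?_
    simp
    ring
  rw [Dop, quadOp_eq_of_hasDerivAt (μ + ν) μ hw₁ hw₂ hx, hw hx]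
  congr 1
  push_cast
  ring

/-- `D_{ν,μ} u = D_{μ,ν} u + (μ−ν)(μ+ν+2)·u` for smooth `u : (0,∞) → ℂ`. -/
theorem statement0 (μ ν : ℝ) (u : ℝ → ℂ) (hu : ContDiffOn ℝ (⊤ : ℕ∞) u (Ioi (0 : ℝ)))
    (x : ℝ) (hx : 0 < x) :
    Dop ν μ u x = Dop μ ν u x + (((μ - ν) * (μ + ν + 2) : ℝ) : ℂ) * u x := by
  obtain ⟨u₁, hu₁, h₁⟩ := exists_hasDerivAt_of_contDiffOn_Ioi hu
  obtain ⟨u₂, hu₂, h₂⟩ := exists_hasDerivAt_of_contDiffOn_Ioi hu₁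
  obtain ⟨u₃, hu₃, h₃⟩ := exists_hasDerivAt_of_contDiffOn_Ioi hu₂
  obtain ⟨u₄, -, h₄⟩ := exists_hasDerivAt_of_contDiffOn_Ioi hu₃
  have hx0 : (x : ℂ) ≠ 0 := Complex.ofReal_ne_zero.mpr hx.ne'
  rw [Dop_eq_of_hasDerivAt ν μ h₁ h₂ h₃ h₄ hx, Dop_eq_of_hasDerivAt μ ν h₁ h₂ h₃ h₄ hx]
  push_cast
  field_simp
  ring
end
end

section
/- Let μ, ν ∈ ℝ. For all smooth compactly supported functions f, g : (0,∞) → ℂ, ∫_0^∞ (D_{μ,ν}f)(x)·conj(g(x))·x^{μ+ν+1} dx = ∫_0^∞ f(x)·conj((D_{μ,ν}g)(x))·x^{μ+ν+1} dx; that is, D_{μ,ν} is a symmetric operator on L²((0,∞), x^{μ+ν+1}dx). -/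
noncomputable section

open Set MeasureTheory

/-- Smooth functions `ℝ → ℂ` with compact support contained in `(0,∞)`. -/
structure IsTest (u : ℝ → ℂ) : Prop where
  contDiff : ContDiff ℝ (⊤ : ℕ∞) u
  hasCompactSupport : HasCompactSupport u
  tsupport_subset : tsupport u ⊆ Ioi (0 : ℝ)

namespace IsTest

variable {u v : ℝ → ℂ}

theorem eq_zero (hu : IsTest u) {x : ℝ} (hx : x ∉ Ioi (0 : ℝ)) : u x = 0 :=
  image_eq_zero_of_notMem_tsupport fun h => hx (hu.tsupport_subset h)

theorem differentiable (hu : IsTest u) : Differentiable ℝ u :=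
  hu.contDiff.differentiable (by simp)

theorem integrable (hu : IsTest u) : Integrable u :=
  hu.contDiff.continuous.integrable_of_hasCompactSupport hu.hasCompactSupport

theorem add (hu : IsTest u) (hv : IsTest v) : IsTest fun x => u x + v x where
  contDiff := hu.contDiff.add hv.contDiff
  hasCompactSupport := hu.hasCompactSupport.add hv.hasCompactSupport
  tsupport_subset := (tsupport_add u v).trans
    (union_subset hu.tsupport_subset hv.tsupport_subset)

theorem mul_left (hu : IsTest u) {c : ℝ → ℂ} (hc : ContDiffOn ℝ (⊤ : ℕ∞) c (Ioi 0)) :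
    IsTest fun x => c x * u x where
  contDiff := by
    rw [contDiff_iff_contDiffAt]
    intro x
    by_cases hx : x ∈ tsupport u
    · exact (hc.contDiffAt (Ioi_mem_nhds (hu.tsupport_subset hx))).mul hu.contDiff.contDiffAt
    · refine (contDiffAt_const (c := (0 : ℂ))).congr_of_eventuallyEq ?_
      filter_upwards [notMem_tsupport_iff_eventuallyEq.mp hx] with y hy
      simp [hy]
  hasCompactSupport := hu.hasCompactSupport.mul_left
  tsupport_subset := tsupport_mul_subset_right.trans hu.tsupport_subset

theorem const_mul (hu : IsTest u) (c : ℂ) : IsTest fun x => c * u x :=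
  hu.mul_left contDiffOn_const

theorem mul (hu : IsTest u) (hv : IsTest v) : IsTest fun x => u x * v x :=
  hv.mul_left hu.contDiff.contDiffOn

theorem sub (hu : IsTest u) (hv : IsTest v) : IsTest fun x => u x - v x := by
  simpa [sub_eq_add_neg] using hu.add (hv.const_mul (-1))

theorem deriv (hu : IsTest u) : IsTest (deriv u) where
  contDiff := (contDiff_infty_iff_deriv.mp hu.contDiff).2
  hasCompactSupport := hu.hasCompactSupport.deriv
  tsupport_subset := tsupport_deriv_subset.trans hu.tsupport_subset

theorem conj (hu : IsTest u) : IsTest fun x => (starRingEnd ℂ) (u x) where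
  contDiff := Complex.conjCLE.contDiff.comp hu.contDiff
  hasCompactSupport := hu.hasCompactSupport.comp_left (map_zero (starRingEnd ℂ))
  tsupport_subset := (closure_mono (Function.support_comp_subset (map_zero (starRingEnd ℂ)) u)).trans
    hu.tsupport_subset

theorem mul_rpow (hu : IsTest u) (p : ℝ) : IsTest fun x => u x * ((x ^ p : ℝ) : ℂ) := by
  have hc : ContDiffOn ℝ (⊤ : ℕ∞) (fun x : ℝ => ((x ^ p : ℝ) : ℂ)) (Ioi 0) :=
    Complex.ofRealCLM.contDiff.comp_contDiffOn
      (contDiffOn_id.rpow_const_of_ne fun x hx => ne_of_gt hx)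
  simpa only [mul_comm] using hu.mul_left hc

theorem eulerOp (hu : IsTest u) : IsTest (eulerOp u) :=
  hu.deriv.mul_left Complex.ofRealCLM.contDiff.contDiffOn

theorem quadOp (hu : IsTest u) (a b : ℝ) : IsTest (quadOp a b u) :=
  have h := hu.eulerOp.add (hu.const_mul b)
  (h.eulerOp.add (h.const_mul a)).sub
    (hu.mul_left (Complex.ofRealCLM.contDiff.pow 2).contDiffOn)

theorem integral_deriv_eq_zero (hu : IsTest u) : ∫ x in Ioi (0 : ℝ), _root_.deriv u x = 0 := by
  rw [setIntegral_eq_integral_of_forall_compl_eq_zero fun x hx => hu.deriv.eq_zero hx]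
  exact integral_eq_zero_of_hasDerivAt_of_integrable
    (fun x => (hu.differentiable x).hasDerivAt) hu.deriv.integrable hu.integrable

end IsTest

theorem deriv_conj (u : ℝ → ℂ) (x : ℝ) :
    deriv (fun y => (starRingEnd ℂ) (u y)) x = (starRingEnd ℂ) (deriv u x) :=
  deriv.star

theorem eulerOp_conj (u : ℝ → ℂ) :
    eulerOp (fun y => (starRingEnd ℂ) (u y)) = fun x => (starRingEnd ℂ) (eulerOp u x) := by
  funext x
  simp [eulerOp, deriv_conj]

theorem quadOp_conj (a b : ℝ) (u : ℝ → ℂ) :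
    quadOp a b (fun y => (starRingEnd ℂ) (u y)) = fun x => (starRingEnd ℂ) (quadOp a b u x) := by
  have h : (fun y => eulerOp (fun z => (starRingEnd ℂ) (u z)) y + (b : ℂ) * (starRingEnd ℂ) (u y))
      = fun y => (starRingEnd ℂ) (eulerOp u y + (b : ℂ) * u y) := by
    simp [eulerOp_conj]
  funext x
  rw [quadOp, h, eulerOp_conj, eulerOp_conj]
  simp [quadOp]

/-- `(θ + μ + ν)(θ + μ) − x²` is the transpose of `θ(θ + ν) − x²` for the weight `x^{μ+ν−1}`. -/
theorem integral_quadOp_mul (μ ν : ℝ) {v h : ℝ → ℂ} (hv : IsTest v) (hh : IsTest h) :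
    ∫ x in Ioi (0 : ℝ), quadOp (μ + ν) μ v x * h x * ((x ^ (μ + ν - 1) : ℝ) : ℂ)
      = ∫ x in Ioi (0 : ℝ), v x * quadOp 0 ν h x * ((x ^ (μ + ν - 1) : ℝ) : ℂ) := by
  have hw : IsTest fun x => (eulerOp v x + (μ : ℂ) * v x) * h x - v x * eulerOp h x :=
    ((hv.eulerOp.add (hv.const_mul μ)).mul hh).sub (hv.mul hh.eulerOp)
  rw [← sub_eq_zero, ← integral_sub
    (((hv.quadOp (μ + ν) μ).mul hh).mul_rpow (μ + ν - 1)).integrable.integrableOn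
    ((hv.mul (hh.quadOp 0 ν)).mul_rpow (μ + ν - 1)).integrable.integrableOn,
    ← (hw.mul_rpow (μ + ν)).integral_deriv_eq_zero]
  refine setIntegral_congr_fun measurableSet_Ioi fun x (hx : 0 < x) => ?_
  have dv := (hv.differentiable x).hasDerivAt
  have dh := (hh.differentiable x).hasDerivAt
  have dv' := (hv.eulerOp.differentiable x).hasDerivAt
  have dh' := (hh.eulerOp.differentiable x).hasDerivAt
  have dp : HasDerivAt (fun y : ℝ => ((y ^ (μ + ν) : ℝ) : ℂ))
      (((μ + ν) * x ^ (μ + ν - 1) : ℝ) : ℂ) x :=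
    (Real.hasDerivAt_rpow_const (Or.inl hx.ne')).ofReal_comp
  have hp : x ^ (μ + ν) = x ^ (μ + ν - 1) * x := by
    rw [← Real.rpow_add_one hx.ne', sub_add_cancel]
  have d1 := dv'.add (dv.const_mul (μ : ℂ))
  have d2 := dh'.add (dh.const_mul (ν : ℂ))
  have dW := ((d1.mul dh).sub (dv.mul dh')).mul dp
  have e1 : eulerOp (fun y => eulerOp v y + (μ : ℂ) * v y) x
      = x * (deriv (eulerOp v) x + μ * deriv v x) := congrArg _ d1.deriv
  have e2 : eulerOp (fun y => eulerOp h y + (ν : ℂ) * h y) x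
      = x * (deriv (eulerOp h) x + ν * deriv h x) := congrArg _ d2.deriv
  refine Eq.trans ?_ dW.deriv.symm
  simp only [quadOp, e1, e2, hp, Pi.add_apply, Pi.mul_apply, Pi.sub_apply]
  simp only [eulerOp]
  push_cast
  ring

theorem Dop_mul_rpow (μ ν : ℝ) (u : ℝ → ℂ) {x : ℝ} (hx : 0 < x) :
    Dop μ ν u x * ((x ^ (μ + ν + 1) : ℝ) : ℂ)
      = quadOp (μ + ν) μ (quadOp 0 ν u) x * ((x ^ (μ + ν - 1) : ℝ) : ℂ) := by
  have hp : x ^ (μ + ν + 1) = x ^ (μ + ν - 1) * x ^ 2 := by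
    rw [← Real.rpow_add_natCast hx.ne']
    congr 1
    push_cast
    ring
  have hx' : (x : ℂ) ≠ 0 := Complex.ofReal_ne_zero.mpr hx.ne'
  rw [Dop, hp]
  push_cast
  field_simp

/-- `D_{μ,ν}` is a symmetric operator on `L²((0,∞), x^{μ+ν+1}dx)`: for smooth compactly
supported `f, g : (0,∞) → ℂ` one has
`∫₀^∞ (D_{μ,ν}f)(x)·conj(g(x))·x^{μ+ν+1} dx = ∫₀^∞ f(x)·conj((D_{μ,ν}g)(x))·x^{μ+ν+1} dx`. -/
theorem statement1 (μ ν : ℝ) (f g : ℝ → ℂ)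
    (hf : ContDiff ℝ (⊤ : ℕ∞) f) (hfc : HasCompactSupport f) (hfs : tsupport f ⊆ Ioi (0 : ℝ))
    (hg : ContDiff ℝ (⊤ : ℕ∞) g) (hgc : HasCompactSupport g) (hgs : tsupport g ⊆ Ioi (0 : ℝ)) :
    ∫ x in Ioi (0 : ℝ), Dop μ ν f x * (starRingEnd ℂ) (g x) * ((x ^ (μ + ν + 1) : ℝ) : ℂ)
      = ∫ x in Ioi (0 : ℝ),
          f x * (starRingEnd ℂ) (Dop μ ν g x) * ((x ^ (μ + ν + 1) : ℝ) : ℂ) := by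
  have tf : IsTest f := ⟨hf, hfc, hfs⟩
  have tg : IsTest g := ⟨hg, hgc, hgs⟩
  calc
    _ = ∫ x in Ioi (0 : ℝ), quadOp (μ + ν) μ (quadOp 0 ν f) x * (starRingEnd ℂ) (g x)
          * ((x ^ (μ + ν - 1) : ℝ) : ℂ) := by
      refine setIntegral_congr_fun measurableSet_Ioi fun x hx => ?_
      simp only [mul_right_comm, Dop_mul_rpow μ ν f hx]
    _ = ∫ x in Ioi (0 : ℝ), quadOp 0 ν f x * (starRingEnd ℂ) (quadOp 0 ν g x)
          * ((x ^ (μ + ν - 1) : ℝ) : ℂ) := by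
      rw [integral_quadOp_mul μ ν (tf.quadOp 0 ν) tg.conj, quadOp_conj]
    _ = ∫ x in Ioi (0 : ℝ), (starRingEnd ℂ) (quadOp (μ + ν) μ (quadOp 0 ν g) x) * f x
          * ((x ^ (μ + ν - 1) : ℝ) : ℂ) := by
      have h := integral_quadOp_mul μ ν (tg.quadOp 0 ν).conj tf
      rw [quadOp_conj] at h
      simpa only [mul_comm (quadOp 0 ν f _)] using h.symm
    _ = _ := by
      refine setIntegral_congr_fun measurableSet_Ioi fun x hx => ?_
      have h := congrArg (starRingEnd ℂ) (Dop_mul_rpow μ ν g hx)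
      simp only [map_mul, Complex.conj_ofReal] at h
      linear_combination (-f x) * h
end
end

section
/- Let μ ∈ ℝ and define the second-order operators S_{μ,−1}u = x^{−1}·(θ(θ+μ) − x²)u and S_{μ,+1}u = x^{−1}·(θ(θ+μ+2) + (μ+1) − x²)u on smooth functions on (0,∞). Then for every smooth u : (0,∞) → ℂ and every x > 0, D_{μ,−1}u(x) = S_{μ,−1}(S_{μ,−1}u)(x) − (μ+1)²·u(x) and D_{μ,+1}u(x) = S_{μ,+1}(S_{μ,+1}u)(x) − (μ+1)²·u(x). -/
noncomputable section

open Set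

/-- The second-order operator `S_{μ,−1} = x⁻¹(θ(θ+μ) − x²)`. -/
def Sminus (μ : ℝ) (u : ℝ → ℂ) : ℝ → ℂ := fun x =>
  (eulerOp (fun y => eulerOp u y + (μ : ℂ) * u y) x - (x : ℂ) ^ 2 * u x) / (x : ℂ)

/-- The second-order operator `S_{μ,+1} = x⁻¹(θ(θ+μ+2) + (μ+1) − x²)`. -/
def Splus (μ : ℝ) (u : ℝ → ℂ) : ℝ → ℂ := fun x =>
  (eulerOp (fun y => eulerOp u y + ((μ : ℂ) + 2) * u y) x
    + ((μ : ℂ) + 1) * u x - (x : ℂ) ^ 2 * u x) / (x : ℂ)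

/-- On `(0,∞)`, `f` is differentiable and `θ f = g`. -/
def HasEuler (f g : ℝ → ℂ) : Prop := ∀ y : ℝ, 0 < y → HasDerivAt f (g y / (y : ℂ)) y

namespace HasEuler

variable {f f₁ f₂ g g₁ g₂ : ℝ → ℂ}

lemma eulerOp_eq (h : HasEuler f g) {x : ℝ} (hx : 0 < x) : eulerOp f x = g x := by
  have hx' : (x : ℂ) ≠ 0 := by exact_mod_cast hx.ne'
  rw [eulerOp, (h x hx).deriv]
  field_simp

lemma congr (h : HasEuler f₁ g₁) (hf : EqOn f₂ f₁ (Ioi 0)) (hg : EqOn g₂ g₁ (Ioi 0)) :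
    HasEuler f₂ g₂ := fun y hy => by
  rw [hg hy]
  exact (h y hy).congr_of_eventuallyEq (hf.eventuallyEq_of_mem (Ioi_mem_nhds hy))

lemma add (h₁ : HasEuler f₁ g₁) (h₂ : HasEuler f₂ g₂) :
    HasEuler (fun y => f₁ y + f₂ y) (fun y => g₁ y + g₂ y) := fun y hy => by
  rw [add_div]
  exact (h₁ y hy).add (h₂ y hy)

lemma sub (h₁ : HasEuler f₁ g₁) (h₂ : HasEuler f₂ g₂) :
    HasEuler (fun y => f₁ y - f₂ y) (fun y => g₁ y - g₂ y) := fun y hy => by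
  rw [sub_div]
  exact (h₁ y hy).sub (h₂ y hy)

lemma const_mul (c : ℂ) (h : HasEuler f g) :
    HasEuler (fun y => c * f y) (fun y => c * g y) := fun y hy => by
  rw [mul_div_assoc]
  exact (h y hy).const_mul c

lemma sq_mul (h : HasEuler f g) :
    HasEuler (fun y => (y : ℂ) ^ 2 * f y) (fun y => (y : ℂ) ^ 2 * (g y + 2 * f y)) :=
    fun y hy => by
  have hy' : (y : ℂ) ≠ 0 := by exact_mod_cast hy.ne'
  have hid : HasDerivAt (fun y : ℝ => (y : ℂ)) 1 y := (hasDerivAt_id y).ofReal_comp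
  refine ((hid.fun_pow 2).fun_mul (h y hy)).congr_deriv ?_
  field_simp
  push_cast
  ring

lemma div_id (h : HasEuler f g) :
    HasEuler (fun y => f y / (y : ℂ)) (fun y => (g y - f y) / (y : ℂ)) := fun y hy => by
  have hy' : (y : ℂ) ≠ 0 := by exact_mod_cast hy.ne'
  have hid : HasDerivAt (fun y : ℝ => (y : ℂ)) 1 y := (hasDerivAt_id y).ofReal_comp
  refine ((h y hy).fun_div hid hy').congr_deriv ?_
  field_simp

/-- Expansion of `θ(θ + b)f`. -/
lemma eulerOp_eulerOp_add (h : HasEuler f f₁) (h₁ : HasEuler f₁ f₂) (b : ℂ) {x : ℝ}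
    (hx : 0 < x) :
    eulerOp (fun y => eulerOp f y + b * f y) x = f₂ x + b * f₁ x :=
  ((h₁.add (h.const_mul b)).congr
    (fun y hy => by simp only [h.eulerOp_eq hy]) (fun _ _ => rfl)).eulerOp_eq hx

lemma quadOp_eq (h : HasEuler f f₁) (h₁ : HasEuler f₁ f₂) (a b : ℝ) {x : ℝ} (hx : 0 < x) :
    quadOp a b f x = f₂ x + b * f₁ x + a * (f₁ x + b * f x) - (x : ℂ) ^ 2 * f x := by
  rw [quadOp, h.eulerOp_eulerOp_add h₁ b hx, h.eulerOp_eq hx]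

lemma Sminus_eq (h : HasEuler f f₁) (h₁ : HasEuler f₁ f₂) (μ : ℝ) {x : ℝ} (hx : 0 < x) :
    Sminus μ f x = (f₂ x + μ * f₁ x - (x : ℂ) ^ 2 * f x) / x := by
  rw [Sminus, h.eulerOp_eulerOp_add h₁ μ hx]

lemma Splus_eq (h : HasEuler f f₁) (h₁ : HasEuler f₁ f₂) (μ : ℝ) {x : ℝ} (hx : 0 < x) :
    Splus μ f x = (f₂ x + (μ + 2) * f₁ x + (μ + 1) * f x - (x : ℂ) ^ 2 * f x) / x := by
  rw [Splus, h.eulerOp_eulerOp_add h₁ _ hx]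

end HasEuler

lemma hasEuler_eulerOp {f : ℝ → ℂ} (hf : ContDiffOn ℝ (⊤ : ℕ∞) f (Ioi 0)) :
    HasEuler f (eulerOp f) := fun y hy => by
  have hy' : (y : ℂ) ≠ 0 := by exact_mod_cast hy.ne'
  have hd : DifferentiableAt ℝ f y :=
    (hf.differentiableOn (by simp)).differentiableAt (Ioi_mem_nhds hy)
  refine hd.hasDerivAt.congr_deriv ?_
  rw [eulerOp]
  field_simp

lemma contDiffOn_eulerOp {f : ℝ → ℂ} (hf : ContDiffOn ℝ (⊤ : ℕ∞) f (Ioi 0)) :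
    ContDiffOn ℝ (⊤ : ℕ∞) (eulerOp f) (Ioi 0) :=
  Complex.ofRealCLM.contDiff.contDiffOn.mul (hf.deriv_of_isOpen isOpen_Ioi (by simp))

/-- `D_{μ,−1} = S_{μ,−1}² − (μ+1)²` and `D_{μ,+1} = S_{μ,+1}² − (μ+1)²` on smooth
functions on `(0,∞)`. -/
theorem statement2 (μ : ℝ) (u : ℝ → ℂ) (hu : ContDiffOn ℝ (⊤ : ℕ∞) u (Ioi (0 : ℝ)))
    (x : ℝ) (hx : 0 < x) :
    Dop μ (-1) u x = Sminus μ (Sminus μ u) x - (((μ + 1) ^ 2 : ℝ) : ℂ) * u x ∧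
    Dop μ 1 u x = Splus μ (Splus μ u) x - (((μ + 1) ^ 2 : ℝ) : ℂ) * u x := by
  have hx' : (x : ℂ) ≠ 0 := by exact_mod_cast hx.ne'
  have hu₁ := contDiffOn_eulerOp hu
  have hu₂ := contDiffOn_eulerOp hu₁
  have h₀ := hasEuler_eulerOp hu
  have h₁ := hasEuler_eulerOp hu₁
  have h₂ := hasEuler_eulerOp hu₂
  have h₃ := hasEuler_eulerOp (contDiffOn_eulerOp hu₂)
  set u₁ := eulerOp u
  set u₂ := eulerOp u₁
  set u₃ := eulerOp u₂
  set u₄ := eulerOp u₃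
  have hquad (ν : ℝ) := (((h₂.add (h₁.const_mul (ν : ℂ))).sub h₀.sq_mul).congr (f₂ := quadOp 0 ν u)
    (fun y hy => by simp [h₀.quadOp_eq h₁ 0 ν hy]) (fun _ _ => rfl)).quadOp_eq
    ((h₃.add (h₂.const_mul (ν : ℂ))).sub (h₁.add (h₀.const_mul 2)).sq_mul) (μ + ν) μ hx
  have hminus := (((h₂.add (h₁.const_mul (μ : ℂ))).sub h₀.sq_mul).div_id.congr
    (f₂ := Sminus μ u) (fun y hy => h₀.Sminus_eq h₁ μ hy) (fun _ _ => rfl)).Sminus_eq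
    (((h₃.add (h₂.const_mul (μ : ℂ))).sub (h₁.add (h₀.const_mul 2)).sq_mul).sub
      ((h₂.add (h₁.const_mul (μ : ℂ))).sub h₀.sq_mul)).div_id μ hx
  have hplus := ((((h₂.add (h₁.const_mul ((μ : ℂ) + 2))).add
      (h₀.const_mul ((μ : ℂ) + 1))).sub h₀.sq_mul).div_id.congr
    (f₂ := Splus μ u) (fun y hy => h₀.Splus_eq h₁ μ hy) (fun _ _ => rfl)).Splus_eq
    ((((h₃.add (h₂.const_mul ((μ : ℂ) + 2))).add (h₁.const_mul ((μ : ℂ) + 1))).sub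
      (h₁.add (h₀.const_mul 2)).sq_mul).sub
      (((h₂.add (h₁.const_mul ((μ : ℂ) + 2))).add (h₀.const_mul ((μ : ℂ) + 1))).sub
        h₀.sq_mul)).div_id μ hx
  constructor
  · rw [Dop, hquad, hminus, h₀.quadOp_eq h₁ 0 _ hx, h₀.Sminus_eq h₁ μ hx]
    push_cast
    field_simp
    ring
  · rw [Dop, hquad, hplus, h₀.quadOp_eq h₁ 0 _ hx, h₀.Splus_eq h₁ μ hx]
    push_cast
    field_simp
    ring
end
end

section
/- Let μ ∈ ℝ with μ ∉ {−1,−2,−3,…}, let ν ≥ 1 be an odd integer and j ∈ ℕ₀. Then the coefficient of x^{j+(ν−1)/2} in the polynomial M_j^{μ,ν}(x) equals (−1)^j/j!, and the constant term is M_j^{μ,ν}(0) = 2^{ν−μ−1}·Γ(ν/2)·Γ(j+μ+1)·((μ−ν+2)/2)_j/(j!·Γ((μ+2)/2)·Γ(j+(μ+1)/2)). -/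
noncomputable section

/-- The Laguerre polynomial
`Lₙ^α(z) = ((α+1)ₙ/n!)·Σ_{k=0}^n binom(n,k)·((−1)^k/(α+1)ₖ)·z^k`. -/
def laguerreL (n : ℕ) (α : ℝ) (z : ℝ) : ℝ :=
  (ascPochhammer ℝ n).eval (α + 1) / (n.factorial : ℝ) *
    ∑ k ∈ Finset.range (n + 1),
      (n.choose k : ℝ) * ((-1) ^ k / (ascPochhammer ℝ k).eval (α + 1)) * z ^ k

/-- The polynomial `M_j^{μ,ν}` (for `ν ≥ 1` an odd integer), the inner sum being empty when
`(ν−1)/2 − k < 0`. -/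
def polyM (μ : ℝ) (ν : ℕ) (j : ℕ) (x : ℝ) : ℝ :=
  Real.Gamma ((j : ℝ) + μ + 1) / Real.Gamma ((j : ℝ) + (μ + 1) / 2) *
    ∑ k ∈ Finset.range (j + 1), ∑ i ∈ Finset.range ((ν - 1) / 2 + 1 - k),
      (-1) ^ k *
        (Real.Gamma (((j - k : ℕ) : ℝ) + (μ + 1) / 2) * ((ν - i - 1).factorial : ℝ)) /
        ((k.factorial : ℝ) * Real.Gamma (((j - k : ℕ) : ℝ) + μ + 1) *
          (((ν - 1) / 2 - i - k).factorial : ℝ) * (i.factorial : ℝ)) *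
        laguerreL (j - k) μ x * x ^ i

/-- The Laguerre polynomial as a formal polynomial. -/
def laguerrePoly (n : ℕ) (α : ℝ) : Polynomial ℝ :=
  Polynomial.C ((ascPochhammer ℝ n).eval (α + 1) / (n.factorial : ℝ)) *
    ∑ k ∈ Finset.range (n + 1),
      Polynomial.C ((n.choose k : ℝ) * ((-1) ^ k / (ascPochhammer ℝ k).eval (α + 1))) *
        Polynomial.X ^ k

theorem laguerrePoly_eval (n : ℕ) (α x : ℝ) :
    (laguerrePoly n α).eval x = laguerreL n α x := by
  simp [laguerrePoly, laguerreL, Polynomial.eval_finsetSum]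

theorem laguerrePoly_coeff (n : ℕ) (α : ℝ) (m : ℕ) :
    (laguerrePoly n α).coeff m = if m ≤ n then
      (ascPochhammer ℝ n).eval (α + 1) / (n.factorial : ℝ) *
        ((n.choose m : ℝ) * ((-1) ^ m / (ascPochhammer ℝ m).eval (α + 1))) else 0 := by
  simp only [laguerrePoly, Polynomial.coeff_C_mul, Polynomial.finsetSum_coeff,
    Polynomial.coeff_X_pow, mul_ite, mul_one, mul_zero, Finset.sum_ite_eq, Finset.mem_range,
    Nat.lt_succ_iff]

theorem laguerreL_zero (n : ℕ) (α : ℝ) :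
    laguerreL n α 0 = (ascPochhammer ℝ n).eval (α + 1) / (n.factorial : ℝ) := by
  simp [laguerreL, Finset.sum_range_succ']

theorem Gamma_nat_add_eq_ascPochhammer_mul (a : ℝ) (ha : ∀ n : ℕ, a ≠ -(n : ℝ)) (m : ℕ) :
    Real.Gamma ((m : ℝ) + a) = (ascPochhammer ℝ m).eval a * Real.Gamma a := by
  induction m with
  | zero => simp
  | succ m ih =>
    have h : (m : ℝ) + a ≠ 0 := fun h => ha m (by linarith)
    rw [ascPochhammer_succ_eval,
      show ((m + 1 : ℕ) : ℝ) + a = ((m : ℝ) + a) + 1 by push_cast; ring, Real.Gamma_add_one h, ih]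
    ring

theorem ascPochhammer_sub_one_div_factorial (a : ℝ) (j : ℕ) :
    (ascPochhammer ℝ (j + 1)).eval (a - 1) / ((j + 1).factorial : ℝ) =
      (ascPochhammer ℝ (j + 1)).eval a / ((j + 1).factorial : ℝ) -
        (ascPochhammer ℝ j).eval a / (j.factorial : ℝ) := by
  have h1 : (ascPochhammer ℝ (j + 1)).eval (a - 1) = (a - 1) * (ascPochhammer ℝ j).eval a := by
    simp [ascPochhammer_succ_left]
  rw [h1, ascPochhammer_succ_eval, Nat.factorial_succ]
  have := Nat.factorial_ne_zero j
  push_cast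
  field_simp
  ring

/-- Comparison of the coefficients of `t^j` in `(1 - t)^n (1 - t)^(-a) = (1 - t)^(-(a - n))`. -/
theorem sum_neg_one_pow_choose_mul_ascPochhammer (a : ℝ) (n j : ℕ) :
    ∑ k ∈ Finset.range (j + 1), (-1) ^ k * (n.choose k : ℝ) *
      ((ascPochhammer ℝ (j - k)).eval a / ((j - k).factorial : ℝ)) =
    (ascPochhammer ℝ j).eval (a - n) / (j.factorial : ℝ) := by
  induction n generalizing j with
  | zero => simp [Finset.sum_range_succ']
  | succ n ih =>
    cases j with
    | zero => simp
    | succ j =>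
      rw [show a - ((n + 1 : ℕ) : ℝ) = (a - n) - 1 by push_cast; ring,
        ascPochhammer_sub_one_div_factorial, ← ih (j + 1), ← ih j, Finset.sum_range_succ',
        Finset.sum_range_succ' _ (j + 1), add_sub_right_comm, ← Finset.sum_sub_distrib]
      congr 1
      · refine Finset.sum_congr rfl fun k _ => ?_
        rw [Nat.choose_succ_succ, Nat.add_sub_add_right]
        push_cast
        ring
      · simp

theorem Gamma_half_div_Gamma (μ : ℝ) (hμ : ∀ n : ℕ, μ ≠ -((n : ℝ) + 1)) (n : ℕ) :
    2 ^ (((2 * n + 1 : ℕ) : ℝ) - μ - 1) * Real.Gamma (((2 * n + 1 : ℕ) : ℝ) / 2) /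
      Real.Gamma ((μ + 2) / 2) =
    Real.Gamma ((μ + 1) / 2) / Real.Gamma (μ + 1) * ((2 * n).factorial / n.factorial) := by
  have h1 := Real.Gamma_mul_Gamma_add_half ((μ + 1) / 2)
  have h2 := Real.Gamma_mul_Gamma_add_half ((n : ℝ) + 1 / 2)
  rw [show (μ + 1) / 2 + 1 / 2 = (μ + 2) / 2 by ring, show 2 * ((μ + 1) / 2) = μ + 1 by ring,
    show 1 - (μ + 1) = -μ by ring] at h1
  rw [show (n : ℝ) + 1 / 2 + 1 / 2 = n + 1 by ring, Real.Gamma_nat_eq_factorial,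
    show 2 * ((n : ℝ) + 1 / 2) = ((2 * n : ℕ) : ℝ) + 1 by push_cast; ring,
    Real.Gamma_nat_eq_factorial,
    show 1 - (((2 * n : ℕ) : ℝ) + 1) = -((2 * n : ℕ) : ℝ) by ring,
    Real.rpow_neg (by norm_num)] at h2
  have g1 : Real.Gamma ((μ + 2) / 2) ≠ 0 := Real.Gamma_ne_zero fun m h =>
    hμ (2 * m + 1) (by push_cast; linarith)
  have g2 : Real.Gamma (μ + 1) ≠ 0 := Real.Gamma_ne_zero fun m h => hμ m (by linarith)
  have f1 : (n.factorial : ℝ) ≠ 0 := by exact_mod_cast n.factorial_ne_zero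
  have f2 : (2 : ℝ) ^ ((2 * n : ℕ) : ℝ) ≠ 0 := by positivity
  rw [show ((2 * n + 1 : ℕ) : ℝ) - μ - 1 = ((2 * n : ℕ) : ℝ) + -μ by push_cast; ring,
    show ((2 * n + 1 : ℕ) : ℝ) / 2 = (n : ℝ) + 1 / 2 by push_cast; ring,
    Real.rpow_add (by norm_num)]
  generalize (2 : ℝ) ^ ((2 * n : ℕ) : ℝ) = A at *
  generalize (2 : ℝ) ^ (-μ) = B at *
  have h2' : A * (Real.Gamma (n + 1 / 2) * n.factorial) = (2 * n).factorial * √Real.pi := by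
    rw [h2]; field_simp
  rw [div_mul_div_comm, div_eq_div_iff g1 (mul_ne_zero g2 f1)]
  linear_combination (B * Real.Gamma (μ + 1)) * h2' - ((2 * n).factorial : ℝ) * h1

theorem polyM_coeff (μ : ℝ) (hμ : ∀ n : ℕ, μ ≠ -((n : ℝ) + 1)) (n j : ℕ) :
    ∃ P : Polynomial ℝ, (∀ x : ℝ, polyM μ (2 * n + 1) j x = P.eval x) ∧
      P.coeff (j + n) = (-1) ^ j / (j.factorial : ℝ) := by
  have hn : (2 * n + 1 - 1) / 2 = n := by omega
  refine ⟨Polynomial.C (Real.Gamma ((j : ℝ) + μ + 1) / Real.Gamma ((j : ℝ) + (μ + 1) / 2)) *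
    ∑ k ∈ Finset.range (j + 1), ∑ i ∈ Finset.range (n + 1 - k),
      Polynomial.C ((-1) ^ k *
        (Real.Gamma (((j - k : ℕ) : ℝ) + (μ + 1) / 2) * ((2 * n + 1 - i - 1).factorial : ℝ)) /
        ((k.factorial : ℝ) * Real.Gamma (((j - k : ℕ) : ℝ) + μ + 1) *
          ((n - i - k).factorial : ℝ) * (i.factorial : ℝ))) *
        laguerrePoly (j - k) μ * Polynomial.X ^ i, fun x => ?_, ?_⟩
  · simp only [polyM, hn, Polynomial.eval_mul, Polynomial.eval_C, Polynomial.eval_finsetSum,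
      Polynomial.eval_pow, Polynomial.eval_X, laguerrePoly_eval]
  · simp only [Polynomial.coeff_C_mul, Polynomial.finsetSum_coeff, Polynomial.coeff_mul_X_pow',
      laguerrePoly_coeff]
    rw [Finset.sum_eq_single_of_mem 0 (by simp), Finset.sum_eq_single_of_mem n (by simp)]
    · have g1 : Real.Gamma ((j : ℝ) + μ + 1) ≠ 0 := Real.Gamma_ne_zero fun m h =>
        hμ (m + j) (by push_cast; linarith)
      have g2 : Real.Gamma ((j : ℝ) + (μ + 1) / 2) ≠ 0 := Real.Gamma_ne_zero fun m h =>
        hμ (2 * (m + j)) (by push_cast; linarith)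
      have g3 : (ascPochhammer ℝ j).eval (μ + 1) ≠ 0 := by
        intro h
        have := Gamma_nat_add_eq_ascPochhammer_mul (μ + 1)
          (fun m h => hμ m (by linarith)) j
        rw [h, zero_mul, ← add_assoc] at this
        exact g1 this
      have f1 : (n.factorial : ℝ) ≠ 0 := by exact_mod_cast n.factorial_ne_zero
      have f2 : (j.factorial : ℝ) ≠ 0 := by exact_mod_cast j.factorial_ne_zero
      simp [show 2 * n + 1 - n - 1 = n by omega]
      generalize Real.Gamma ((j : ℝ) + (μ + 1) / 2) = G at *
      field_simp
    · intro i hi hin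
      rw [Finset.mem_range] at hi
      rw [if_pos (by omega), if_neg (by omega), mul_zero]
    · intro k hk hk0
      refine Finset.sum_eq_zero fun i hi => ?_
      rw [Finset.mem_range] at hi hk
      rw [if_pos (by omega), if_neg (by omega), mul_zero]

theorem polyM_zero (μ : ℝ) (hμ : ∀ n : ℕ, μ ≠ -((n : ℝ) + 1)) (n j : ℕ) :
    polyM μ (2 * n + 1) j 0 =
      Real.Gamma ((μ + 1) / 2) / Real.Gamma (μ + 1) * ((2 * n).factorial / n.factorial) *
        (Real.Gamma ((j : ℝ) + μ + 1) / Real.Gamma ((j : ℝ) + (μ + 1) / 2)) *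
        ((ascPochhammer ℝ j).eval ((μ + 1) / 2 - n) / (j.factorial : ℝ)) := by
  have hn : (2 * n + 1 - 1) / 2 = n := by omega
  have hG : ∀ m : ℕ, Real.Gamma ((m : ℝ) + μ + 1) =
      (ascPochhammer ℝ m).eval (μ + 1) * Real.Gamma (μ + 1) := fun m => by
    rw [add_assoc, Gamma_nat_add_eq_ascPochhammer_mul _ fun m h => hμ m (by linarith)]
  have g1 : ∀ m : ℕ, Real.Gamma ((m : ℝ) + μ + 1) ≠ 0 := fun m => Real.Gamma_ne_zero fun p h =>
    hμ (p + m) (by push_cast; linarith)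
  have g2 : Real.Gamma (μ + 1) ≠ 0 := by simpa using g1 0
  have g3 : ∀ m : ℕ, (ascPochhammer ℝ m).eval (μ + 1) ≠ 0 := fun m h =>
    g1 m (by rw [hG, h, zero_mul])
  have f : ∀ m : ℕ, (m.factorial : ℝ) ≠ 0 := fun m => by exact_mod_cast m.factorial_ne_zero
  rw [← sum_neg_one_pow_choose_mul_ascPochhammer, mul_right_comm, polyM, mul_comm, Finset.mul_sum]
  congr 1
  refine Finset.sum_congr rfl fun k _ => ?_
  rw [hn]
  rcases lt_or_ge n k with hk | hk
  · rw [Nat.sub_eq_zero_of_le (by omega), Nat.choose_eq_zero_of_lt hk]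
    simp
  · rw [Finset.sum_eq_single_of_mem 0 (by simp; omega) (fun i _ hi => by simp [hi]),
      laguerreL_zero, hG, Gamma_nat_add_eq_ascPochhammer_mul ((μ + 1) / 2)
        (fun m h => hμ (2 * m) (by push_cast; linarith)), Nat.cast_choose ℝ hk]
    have := g3 (j - k)
    have := f (j - k)
    have := f (n - k)
    have := f k
    have := f n
    simp only [Nat.sub_zero, Nat.add_sub_cancel, pow_zero, Nat.factorial_zero, Nat.cast_one]
    field_simp

/-- For `μ ∉ {−1,−2,−3,…}` and odd `ν ≥ 1`: the coefficient of `x^{j+(ν−1)/2}` in the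
polynomial `M_j^{μ,ν}` is `(−1)^j/j!`, and its constant term is
`M_j^{μ,ν}(0) = 2^{ν−μ−1}·Γ(ν/2)·Γ(j+μ+1)·((μ−ν+2)/2)ⱼ/(j!·Γ((μ+2)/2)·Γ(j+(μ+1)/2))`. -/
theorem statement15 (μ : ℝ) (hμ : ∀ n : ℕ, μ ≠ -((n : ℝ) + 1))
    (ν : ℕ) (hν : Odd ν) (hν1 : 1 ≤ ν) (j : ℕ) :
    (∃ P : Polynomial ℝ, (∀ x : ℝ, polyM μ ν j x = P.eval x) ∧
      P.coeff (j + (ν - 1) / 2) = (-1) ^ j / (j.factorial : ℝ)) ∧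
    polyM μ ν j 0
      = 2 ^ ((ν : ℝ) - μ - 1) * Real.Gamma ((ν : ℝ) / 2) * Real.Gamma ((j : ℝ) + μ + 1) *
          (ascPochhammer ℝ j).eval ((μ - (ν : ℝ) + 2) / 2) /
        ((j.factorial : ℝ) * Real.Gamma ((μ + 2) / 2) *
          Real.Gamma ((j : ℝ) + (μ + 1) / 2)) := by
  obtain ⟨n, rfl⟩ := hν
  constructor
  · rw [show (2 * n + 1 - 1) / 2 = n by omega]
    exact polyM_coeff μ hμ n j
  · rw [polyM_zero μ hμ, ← Gamma_half_div_Gamma μ hμ,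
      show (μ - ((2 * n + 1 : ℕ) : ℝ) + 2) / 2 = (μ + 1) / 2 - n by push_cast; ring]
    ring
end
end
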